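/- arXiv:2504.14382 — 3 statements merged into one kernel-verified Lean document; each statement's English description precedes it below -/
import Mathlib

section
/- Let M be an n×n idempotent matrix with non-negative integer entries (M·M = M over ℕ) such that every row of M is nonzero. Then for every index i whose column is nonzero (i.e., there exists k with M k i ≠ 0): M i i = 1, and for every index j ≠ i whose column is also nonzero, M j i = 0. (In the language of monic monomial retractions: if f_i ≠ 1 then f_i = X_i · ψ_i, where ψ_i is a monic monomial involving only those variables X_j with f_j = 1.) -/
/-- If no row of an idempotent ℕ-matrix vanishes, then every row whose index is that of a nonzero
column has entry sum 1. -/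
theorem Matrix.row_sum_eq_one_of_idempotent {ι : Type*} [Fintype ι] {M : Matrix ι ι ℕ}
    (hM : M * M = M) (hrows : ∀ i, ∃ j, M i j ≠ 0) {k j : ι} (hkj : M k j ≠ 0) :
    ∑ l, M j l = 1 := by
  have hpos (a : ι) : 1 ≤ ∑ l, M a l := by
    obtain ⟨b, hb⟩ := hrows a
    exact (Nat.one_le_iff_ne_zero.mpr hb).trans
      (Finset.single_le_sum (fun _ _ => Nat.zero_le _) (Finset.mem_univ b))
  have hsum : ∑ a, M k a = ∑ a, M k a * ∑ l, M a l := by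
    conv_lhs => rw [← hM]
    simp only [Matrix.mul_apply, Finset.mul_sum]
    exact Finset.sum_comm
  have hle : ∀ a ∈ Finset.univ, M k a ≤ M k a * ∑ l, M a l :=
    fun a _ => Nat.le_mul_of_pos_right _ (hpos a)
  have h := (Finset.sum_eq_sum_iff_of_le hle).mp hsum j (Finset.mem_univ j)
  exact Nat.eq_of_mul_eq_mul_left (Nat.pos_of_ne_zero hkj) (by rw [← h, mul_one])

/-- A family of natural numbers with sum 1 and a nonzero term is the indicator of that term. -/
theorem Finset.eq_one_and_eq_zero_of_sum_eq_one {ι : Type*} [Fintype ι] {f : ι → ℕ}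
    (hf : ∑ l, f l = 1) {i : ι} (hi : f i ≠ 0) : f i = 1 ∧ ∀ l, l ≠ i → f l = 0 := by
  classical
  rw [← Finset.add_sum_erase _ f (Finset.mem_univ i)] at hf
  have h0 : ∑ l ∈ Finset.univ.erase i, f l = 0 := by omega
  refine ⟨by omega, fun l hl => ?_⟩
  exact Finset.sum_eq_zero_iff.mp h0 l (Finset.mem_erase.mpr ⟨hl, Finset.mem_univ l⟩)

/-- If no row of an idempotent ℕ-matrix vanishes, then every nonzero column has diagonal
entry 1. -/
theorem Matrix.diag_eq_one_of_idempotent {ι : Type*} [Fintype ι] {M : Matrix ι ι ℕ}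
    (hM : M * M = M) (hrows : ∀ i, ∃ j, M i j ≠ 0) {k i : ι} (hki : M k i ≠ 0) :
    M i i = 1 := by
  rw [← hM, Matrix.mul_apply] at hki
  obtain ⟨j, -, hj⟩ := Finset.exists_ne_zero_of_sum_ne_zero hki
  obtain ⟨hkj, hji⟩ := mul_ne_zero_iff.mp hj
  obtain ⟨hone, hzero⟩ := Finset.eq_one_and_eq_zero_of_sum_eq_one
    (Matrix.row_sum_eq_one_of_idempotent hM hrows hkj) hji
  have h : ∑ l, M j l * M l i = 1 := by rw [← Matrix.mul_apply, hM, hone]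
  rwa [Finset.sum_eq_single i (fun l _ hl => by rw [hzero l hl, zero_mul])
    (fun hn => absurd (Finset.mem_univ i) hn), hone, one_mul] at h

/-- For an idempotent ℕ-matrix with nonzero rows, every nonzero column i has
diagonal entry 1, and its entries at the other nonzero-column indices vanish. -/
theorem nonzero_columns_of_idempotent_nat_matrix (n : ℕ)
    (M : Matrix (Fin n) (Fin n) ℕ) (hM : M * M = M)
    (hrows : ∀ i : Fin n, ∃ j : Fin n, M i j ≠ 0) :
    ∀ i : Fin n, (∃ k : Fin n, M k i ≠ 0) →
      M i i = 1 ∧ ∀ j : Fin n, j ≠ i → (∃ k : Fin n, M k j ≠ 0) → M j i = 0 := by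
  rintro i ⟨k, hk⟩
  refine ⟨Matrix.diag_eq_one_of_idempotent hM hrows hk, ?_⟩
  rintro j hji ⟨a, ha⟩
  have hjj : M j j ≠ 0 := by simp [Matrix.diag_eq_one_of_idempotent hM hrows ha]
  exact (Finset.eq_one_and_eq_zero_of_sum_eq_one
    (Matrix.row_sum_eq_one_of_idempotent hM hrows ha) hjj).2 i hji.symm
end

section
/- Let R be a nontrivial commutative ring and B = R[X_1,…,X_n]. Let φ, ψ : B → B be non-degenerate monic monomial R-retractions, with φ(X_i) = monomial(d_i, 1) and ψ(X_i) = monomial(e_i, 1). Then φ and ψ have the same image (φ.range = ψ.range) if and only if there exists a permutation τ of {1,…,n} such that (1) e_{τ(i)} = d_i for all i (the exponent matrix of ψ is obtained by applying τ to the columns of the exponent matrix of φ), and (2) for every i with d_i ≠ 0, the index l = τ(i) satisfies d_i(l) = 1 and d_k(l) = 0 for all k ≠ i (i.e., τ(i) lies in the set Γ_i of row indices l such that the l-th entry of column d_i is 1 and every other entry of the l-th row of the exponent matrix is 0). -/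
open MvPolynomial

section

variable {R : Type*} [CommRing R] {n : ℕ} {d e : Fin n → (Fin n →₀ ℕ)}

theorem aeval_monomial_monomial_one (v : Fin n →₀ ℕ) :
    aeval (R := R) (fun i : Fin n => monomial (d i) (1 : R)) (monomial v (1 : R)) =
      monomial (∑ l, v l • d l) 1 := by
  rw [aeval_monomial, Finsupp.prod_fintype _ _ (by simp), monomial_sum_one]
  simp [monomial_pow]

/-- A monic monomial in the image of an idempotent monomial map is fixed by it. -/
theorem sum_smul_eq_of_monomial_mem_range [Nontrivial R]
    (he : (aeval (R := R) (fun i : Fin n => monomial (e i) (1 : R))).comp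
        (aeval (R := R) (fun i : Fin n => monomial (e i) (1 : R))) =
      aeval (R := R) (fun i : Fin n => monomial (e i) (1 : R)))
    {v : Fin n →₀ ℕ}
    (hv : monomial v (1 : R) ∈
      (aeval (R := R) (fun i : Fin n => monomial (e i) (1 : R))).range) :
    ∑ l, v l • e l = v := by
  obtain ⟨p, hp⟩ := hv
  have h := DFunLike.congr_fun he p
  rw [AlgHom.comp_apply] at h
  change aeval _ p = _ at hp
  rw [hp, aeval_monomial_monomial_one] at h
  exact monomial_left_injective one_ne_zero h

theorem monomial_mem_range_aeval (i : Fin n) :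
    monomial (d i) (1 : R) ∈
      (aeval (R := R) (fun i : Fin n => monomial (d i) (1 : R))).range :=
  ⟨X i, by simp⟩

theorem le_of_sum_smul_eq {v : Fin n →₀ ℕ} (hv : ∑ l, v l • d l = v) {l : Fin n}
    (hl : v l ≠ 0) : d l ≤ v := by
  intro j
  have h := DFunLike.congr_fun hv j
  simp only [Finsupp.finsetSum_apply, Finsupp.smul_apply, smul_eq_mul] at h
  rw [← h]
  calc d l j ≤ v l * d l j := Nat.le_mul_of_pos_left _ (Nat.pos_of_ne_zero hl)
    _ ≤ ∑ l, v l * d l j :=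
      Finset.single_le_sum (f := fun l => v l * d l j) (by simp) (Finset.mem_univ l)

theorem exists_ne_zero_of_sum_smul_eq {v : Fin n →₀ ℕ} (hv : ∑ l, v l • d l = v) {j : Fin n}
    (hj : v j ≠ 0) : ∃ l, v l ≠ 0 ∧ d l j ≠ 0 := by
  have h := DFunLike.congr_fun hv j
  simp only [Finsupp.finsetSum_apply, Finsupp.smul_apply, smul_eq_mul] at h
  rw [← h] at hj
  obtain ⟨l, -, hl⟩ := Finset.exists_ne_zero_of_sum_ne_zero hj
  exact ⟨l, left_ne_zero_of_mul hl, right_ne_zero_of_mul hl⟩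

/-- In an idempotent matrix of natural numbers without zero rows, the row sum at the index of a
nonzero column is one. -/
theorem sum_apply_eq_one (hd : ∀ i, ∑ l, d i l • d l = d i) (hnd : ∀ j, ∃ i, d i j ≠ 0)
    {i : Fin n} (hi : d i ≠ 0) : ∑ k, d k i = 1 := by
  obtain ⟨j, hj⟩ := DFunLike.ne_iff.mp hi
  have hpos (i : Fin n) : 1 ≤ ∑ k, d k i := by
    obtain ⟨k, hk⟩ := hnd i
    exact (Nat.one_le_iff_ne_zero.mpr hk).trans
      (Finset.single_le_sum (f := fun k => d k i) (by simp) (Finset.mem_univ k))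
  have hsum : ∑ i, d i j * 1 = ∑ i, d i j * ∑ k, d k i := by
    simp_rw [Finset.mul_sum]
    rw [Finset.sum_comm]
    refine Finset.sum_congr rfl fun k _ => ?_
    have h := DFunLike.congr_fun (hd k) j
    simp only [Finsupp.finsetSum_apply, Finsupp.smul_apply, smul_eq_mul] at h
    simpa [mul_comm] using h.symm
  have h := (Finset.sum_eq_sum_iff_of_le fun i _ => Nat.mul_le_mul_left (d i j) (hpos i)).mp hsum i
    (Finset.mem_univ i)
  exact (Nat.eq_of_mul_eq_mul_left (Nat.pos_of_ne_zero hj) h).symm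

/-- In an idempotent matrix of natural numbers without zero rows, the row at the index of a
nonzero column is the corresponding standard basis vector. -/
theorem apply_self_eq_one_and_apply_eq_zero (hd : ∀ i, ∑ l, d i l • d l = d i)
    (hnd : ∀ j, ∃ i, d i j ≠ 0) {i : Fin n} (hi : d i ≠ 0) :
    d i i = 1 ∧ ∀ k, k ≠ i → d k i = 0 := by
  have hrow {i k : Fin n} (hi : d i ≠ 0) (hk : d k i ≠ 0) : d k i = 1 ∧ ∀ m, m ≠ k → d m i = 0 := by
    have h := sum_apply_eq_one hd hnd hi
    rw [← Finset.add_sum_erase _ _ (Finset.mem_univ k)] at h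
    have h0 : ∑ m ∈ Finset.univ.erase k, d m i = 0 := by omega
    refine ⟨by omega, fun m hm => ?_⟩
    exact Finset.sum_eq_zero_iff.mp h0 m (by simp [hm])
  obtain ⟨k, hk⟩ := hnd i
  obtain ⟨j, hj⟩ := DFunLike.ne_iff.mp hi
  obtain ⟨l, hil, hlj⟩ := exists_ne_zero_of_sum_smul_eq (hd i) hj
  have hl : d l ≠ 0 := DFunLike.ne_iff.mpr ⟨j, hlj⟩
  have hkl : d k l ≠ 0 := by
    have := le_of_sum_smul_eq (hd k) hk l
    omega
  obtain rfl : k = i := by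
    by_contra hne
    exact hkl ((hrow hl hil).2 k hne)
  exact hrow hi hk

/-- Each nonzero column of one exponent matrix occurs in the other one, at an admissible index. -/
theorem exists_eq_and_admissible (hd : ∀ i, ∑ l, d i l • d l = d i)
    (he : ∀ i, ∑ l, e i l • e l = e i)
    (hdnd : ∀ j, ∃ i, d i j ≠ 0) (hend : ∀ j, ∃ i, e i j ≠ 0)
    (hde : ∀ i, ∑ l, d i l • e l = d i) (hed : ∀ i, ∑ l, e i l • d l = e i)
    {i : Fin n} (hi : d i ≠ 0) :
    ∃ l, e l = d i ∧ d i l = 1 ∧ ∀ k, k ≠ i → d k l = 0 := by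
  obtain ⟨hii, hki⟩ := apply_self_eq_one_and_apply_eq_zero hd hdnd hi
  obtain ⟨l, hil, hli⟩ := exists_ne_zero_of_sum_smul_eq (hde i) (j := i) (by omega)
  have hel : e l = d i :=
    le_antisymm (le_of_sum_smul_eq (hde i) hil) (le_of_sum_smul_eq (hed l) hli)
  refine ⟨l, hel, ?_, fun k hk => ?_⟩
  · rw [← hel]
    exact (apply_self_eq_one_and_apply_eq_zero he hend (hel ▸ hi)).1
  · by_contra hkl
    have h := le_of_sum_smul_eq (hde k) hkl i
    rw [hel, hki k hk] at h
    omega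

theorem eq_of_apply_eq (hd : ∀ i, ∑ l, d i l • d l = d i) (hnd : ∀ j, ∃ i, d i j ≠ 0)
    {i k : Fin n} (hi : d i ≠ 0) (h : d i = d k) : i = k := by
  obtain ⟨hii, hki⟩ := apply_self_eq_one_and_apply_eq_zero hd hnd hi
  by_contra hne
  have := hki k (Ne.symm hne)
  rw [← h] at this
  omega

end

/-- Two non-degenerate monic monomial R-retractions have the same image iff the
exponent matrix of one is obtained from the other by a permutation τ of the
columns with τ(i) ∈ Γ_i for every nonzero column i. -/
theorem same_image_iff_exists_admissible_permutation
    (R : Type*) [CommRing R] [Nontrivial R] (n : ℕ)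
    (d e : Fin n → (Fin n →₀ ℕ))
    (hφidem : (aeval (R := R) (fun i : Fin n => monomial (d i) (1 : R))).comp
        (aeval (R := R) (fun i : Fin n => monomial (d i) (1 : R))) =
      aeval (R := R) (fun i : Fin n => monomial (d i) (1 : R)))
    (hψidem : (aeval (R := R) (fun i : Fin n => monomial (e i) (1 : R))).comp
        (aeval (R := R) (fun i : Fin n => monomial (e i) (1 : R))) =
      aeval (R := R) (fun i : Fin n => monomial (e i) (1 : R)))
    (hdnd : ∀ j : Fin n, ∃ i : Fin n, d i j ≠ 0)
    (hend : ∀ j : Fin n, ∃ i : Fin n, e i j ≠ 0) :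
    (aeval (R := R) (fun i : Fin n => monomial (d i) (1 : R))).range =
        (aeval (R := R) (fun i : Fin n => monomial (e i) (1 : R))).range ↔
      ∃ τ : Equiv.Perm (Fin n),
        (∀ i : Fin n, e (τ i) = d i) ∧
        (∀ i : Fin n, d i ≠ 0 →
          d i (τ i) = 1 ∧ ∀ k : Fin n, k ≠ i → d k (τ i) = 0) := by
  constructor
  · intro h
    have hd i := sum_smul_eq_of_monomial_mem_range hφidem (monomial_mem_range_aeval i)
    have he i := sum_smul_eq_of_monomial_mem_range hψidem (monomial_mem_range_aeval i)
    have hde i := sum_smul_eq_of_monomial_mem_range hψidem (h ▸ monomial_mem_range_aeval (d := d) i)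
    have hed i := sum_smul_eq_of_monomial_mem_range hφidem
      (h.symm ▸ monomial_mem_range_aeval (d := e) i)
    choose f hf hfadm using fun i : {i // d i ≠ 0} =>
      exists_eq_and_admissible hd he hdnd hend hde hed i.2
    let g : {i // d i ≠ 0} → {l // e l ≠ 0} := fun i => ⟨f i, (hf i).symm ▸ i.2⟩
    have hg : Function.Bijective g := by
      constructor
      · intro i k hik
        have hfik : f i = f k := congrArg Subtype.val hik
        exact Subtype.ext (eq_of_apply_eq hd hdnd i.2 (by rw [← hf i, ← hf k, hfik]))
      · intro l
        obtain ⟨i, hi, -⟩ := exists_eq_and_admissible he hd hend hdnd hed hde l.2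
        refine ⟨⟨i, hi.symm ▸ l.2⟩, Subtype.ext (eq_of_apply_eq he hend l.2 ?_).symm⟩
        exact hi.symm.trans (hf ⟨i, _⟩).symm
    classical
    let τ := (Equiv.ofBijective g hg).extendSubtype
    have hτ (i : Fin n) (hi : d i ≠ 0) : τ i = f ⟨i, hi⟩ :=
      (Equiv.ofBijective g hg).extendSubtype_apply_of_mem i hi
    refine ⟨τ, fun i => ?_, fun i hi => ?_⟩
    · by_cases hi : d i = 0
      · have := (Equiv.ofBijective g hg).extendSubtype_not_mem i (not_not.mpr hi)
        rw [hi]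
        exact not_not.mp this
      · rw [hτ i hi]
        exact hf ⟨i, hi⟩
    · rw [hτ i hi]
      exact hfadm ⟨i, hi⟩
  · rintro ⟨τ, hτ, -⟩
    have hrange : (fun i => monomial (d i) (1 : R)) = (fun i => monomial (e i) (1 : R)) ∘ τ := by
      ext1 i
      simp [hτ]
    rw [← Algebra.adjoin_range_eq_range_aeval, ← Algebra.adjoin_range_eq_range_aeval, hrange,
      τ.surjective.range_comp]
end

section
/- Let R be a nontrivial commutative ring and B = R[X_1,…,X_n]. Let φ : B → B be a non-degenerate monic monomial R-retraction with φ(X_i) = monomial(d_i, 1). For each i with d_i ≠ 0, set Γ_i = { l | d_i(l) = 1 and d_k(l) = 0 for all k ≠ i }. Then the number of families e : Fin n → (Fin n → ℕ) such that the R-algebra endomorphism ψ_e of B determined by ψ_e(X_i) = monomial(e_i, 1) satisfies ψ_e ∘ ψ_e = ψ_e and ψ_e.range = φ.range equals the product ∏_{i : d_i ≠ 0} |Γ_i|. In particular, only finitely many distinct monic monomial R-retractions of B have the same retract as φ. -/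
open MvPolynomial

/-- The monomial substitution `X_j ↦ X ^ d_j` acts on exponents by `v ↦ ∑ j, v_j • d_j`. -/
lemma aeval_monomial_one {R : Type*} [CommRing R] {n : ℕ} (d : Fin n → (Fin n →₀ ℕ))
    (v : Fin n →₀ ℕ) :
    aeval (R := R) (fun i : Fin n => monomial (d i) (1 : R)) (monomial v (1 : R)) =
      monomial (∑ j, v j • d j) (1 : R) := by
  rw [aeval_monomial, map_one, one_mul, Finsupp.prod_fintype _ _ (fun i => pow_zero _),
    monomial_sum_one]
  simp [monomial_pow]

/-- Composition of monomial substitutions corresponds to multiplication of exponent matrices. -/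
lemma aeval_monomial_comp_eq_iff {R : Type*} [CommRing R] [Nontrivial R] {n : ℕ}
    (d e : Fin n → (Fin n →₀ ℕ)) :
    (aeval (R := R) (fun i : Fin n => monomial (d i) (1 : R))).comp
        (aeval (R := R) (fun i : Fin n => monomial (e i) (1 : R))) =
      aeval (R := R) (fun i : Fin n => monomial (e i) (1 : R)) ↔
    ∀ i k, ∑ j, e i j * d j k = e i k := by
  have key : ∀ i, (∑ j, e i j • d j = e i) ↔ ∀ k, ∑ j, e i j * d j k = e i k := by
    intro i
    rw [DFunLike.ext_iff]
    simp [Finsupp.finsetSum_apply]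
  simp_rw [← key]
  constructor
  · intro h i
    have h1 := DFunLike.congr_fun h (X i)
    rw [AlgHom.comp_apply, aeval_X, aeval_monomial_one] at h1
    exact monomial_left_injective (one_ne_zero (α := R)) h1
  · intro h
    ext1 i
    rw [AlgHom.comp_apply, aeval_X, aeval_monomial_one, h i]

lemma AlgHom.comp_self_of_comp_eq {R A : Type*} [CommSemiring R] [Semiring A]
    [Algebra R A] {f g : A →ₐ[R] A} (hgf : g.comp f = f) (hfg : f.comp g = g) :
    f.comp f = f :=
  calc f.comp f = f.comp (g.comp f) := by rw [hgf]
    _ = (f.comp g).comp f := (AlgHom.comp_assoc f g f).symm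
    _ = f := by rw [hfg, hgf]

/-- Idempotent endomorphisms have the same range iff each fixes the range of the other. -/
lemma AlgHom.range_eq_range_iff_of_comp_self {R A : Type*} [CommSemiring R] [Semiring A]
    [Algebra R A] {f g : A →ₐ[R] A} (hf : f.comp f = f) (hg : g.comp g = g) :
    f.range = g.range ↔ g.comp f = f ∧ f.comp g = g := by
  have fix : ∀ {p q : A →ₐ[R] A}, q.comp q = q → p.range ≤ q.range → q.comp p = p := by
    intro p q hq h
    ext x
    obtain ⟨y, hy⟩ := h ⟨x, rfl⟩
    have hy' : q y = p x := hy
    rw [AlgHom.comp_apply, ← hy', ← AlgHom.comp_apply, hq]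
  have le : ∀ {p q : A →ₐ[R] A}, q.comp p = p → p.range ≤ q.range := by
    rintro p q h _ ⟨x, rfl⟩
    exact ⟨p x, DFunLike.congr_fun h x⟩
  exact ⟨fun h => ⟨fix hg h.le, fix hf h.ge⟩, fun h => le_antisymm (le h.1) (le h.2)⟩

/-- In an idempotent matrix of natural numbers without zero columns, the submatrix on the
indices of the nonzero rows is the identity. -/
lemma apply_eq_ite_of_idempotent {n : ℕ} {d : Fin n → (Fin n →₀ ℕ)}
    (h : ∀ i k, ∑ j, d i j * d j k = d i k) (hnd : ∀ j, ∃ i, d i j ≠ 0)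
    {k : Fin n} (hk : d k ≠ 0) (i : Fin n) : d i k = if i = k then 1 else 0 := by
  classical
  set I := Finset.univ.filter fun i => d i ≠ 0 with hI
  have hmem : ∀ i, i ∈ I ↔ d i ≠ 0 := by simp [hI]
  have ne_of_apply : ∀ {i j}, d i j ≠ 0 → i ∈ I := by
    intro i j hij
    rw [hmem]
    rintro h0
    simp [h0] at hij
  have sumI : ∀ (f : Fin n → ℕ) k, ∑ j ∈ I, f j * d j k = ∑ j, f j * d j k := by
    intro f k
    refine Finset.sum_subset (Finset.subset_univ _) fun j _ hj => ?_
    have : d j = 0 := by simpa [hmem] using hj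
    simp [this]
  set s : Fin n → ℕ := fun k => ∑ i, d i k with hs
  have spos : ∀ k, 0 < s k := by
    intro k
    obtain ⟨i, hi⟩ := hnd k
    exact Finset.sum_pos' (fun _ _ => Nat.zero_le _) ⟨i, Finset.mem_univ _, Nat.pos_of_ne_zero hi⟩
  have sfix : ∀ k, ∑ j ∈ I, s j * d j k = s k := by
    intro k
    rw [sumI]
    simp only [hs, Finset.sum_mul]
    rw [Finset.sum_comm]
    simp [h]
  have row_pos : ∀ i ∈ I, 1 ≤ ∑ k ∈ I, d i k := by
    intro i hi
    obtain ⟨k, hk⟩ := DFunLike.ne_iff.1 ((hmem i).1 hi)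
    rw [← h i k, ← sumI] at hk
    obtain ⟨j, hj, hjk⟩ := Finset.exists_ne_zero_of_sum_ne_zero hk
    have : d i j ≠ 0 := left_ne_zero_of_mul hjk
    exact Finset.sum_pos' (fun _ _ => Nat.zero_le _) ⟨j, hj, Nat.pos_of_ne_zero this⟩
  have total : ∑ j ∈ I, s j = ∑ j ∈ I, s j * ∑ k ∈ I, d j k := by
    simp only [Finset.mul_sum]
    exact (Finset.sum_congr rfl fun k _ => (sfix k).symm).trans Finset.sum_comm
  have row_one : ∀ i ∈ I, ∑ k ∈ I, d i k = 1 := by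
    intro i hi
    have := (Finset.sum_eq_sum_iff_of_le
      (fun j hj => Nat.le_mul_of_pos_right (s j) (row_pos j hj))).1 total i hi
    exact (Nat.mul_eq_left (spos i).ne').1 this.symm
  have split : ∀ {i k}, i ∈ I → k ∈ I → d i k + ∑ j ∈ I.erase k, d i j = 1 := by
    intro i k hi hk
    rw [Finset.add_sum_erase _ _ hk, row_one i hi]
  have off : ∀ {i k}, i ∈ I → k ∈ I → d i k ≠ 0 → ∀ j ∈ I, j ≠ k → d i j = 0 := by
    intro i k hi hk hik j hj hjk
    have h1 := split hi hk
    have h2 := Finset.single_le_sum (f := fun j => d i j) (fun _ _ => Nat.zero_le _)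
      (Finset.mem_erase.2 ⟨hjk, hj⟩)
    omega
  have diag : ∀ k ∈ I, d k k ≠ 0 := by
    intro k hk
    obtain ⟨i, hik⟩ := hnd k
    have hi := ne_of_apply hik
    have h1 := h i k
    rw [← sumI, Finset.sum_eq_single_of_mem k hk fun j hj hjk => by
      rw [off hi hk hik j hj hjk, zero_mul]] at h1
    rw [← h1] at hik
    exact right_ne_zero_of_mul hik
  have hkI := (hmem k).2 hk
  split_ifs with hik
  · subst hik
    have h1 := split hkI hkI
    have h2 := diag i hkI
    omega
  · by_cases hi : i ∈ I
    · exact off hi hi (diag i hi) k hkI (Ne.symm hik)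
    · have : d i = 0 := by simpa [hmem] using hi
      simp [this]

/-- The exponent family placing the nonzero vectors `d i` at the positions `c i`. -/
noncomputable def relocate {n : ℕ} (d : Fin n → (Fin n →₀ ℕ)) (c : {i // d i ≠ 0} → Fin n)
    (l : Fin n) : Fin n →₀ ℕ :=
  ∑ i, if c i = l then d i else 0

lemma relocate_apply {n : ℕ} (d : Fin n → (Fin n →₀ ℕ)) (c : {i // d i ≠ 0} → Fin n)
    (l k : Fin n) : relocate d c l k = ∑ i, if c i = l then d i k else 0 := by
  rw [relocate, Finsupp.finsetSum_apply]
  refine Finset.sum_congr rfl fun i _ => ?_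
  split_ifs <;> rfl

lemma relocate_of_injective {n : ℕ} {d : Fin n → (Fin n →₀ ℕ)} {c : {i // d i ≠ 0} → Fin n}
    (hc : Function.Injective c) (i : {i // d i ≠ 0}) : relocate d c (c i) = d i := by
  simp [relocate, hc.eq_iff]

lemma relocate_of_forall_ne {n : ℕ} {d : Fin n → (Fin n →₀ ℕ)} {c : {i // d i ≠ 0} → Fin n}
    {l : Fin n} (hl : ∀ i, c i ≠ l) : relocate d c l = 0 := by
  simp [relocate, hl]

/-- If `e` and `d` fix each other, then each nonzero `d i` occurs as `e l` for some `l` at which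
only `d i` is nonzero, with value `1`. -/
lemma exists_eq_of_mutually_fixed {n : ℕ} {d e : Fin n → (Fin n →₀ ℕ)}
    (hd : ∀ i, d i ≠ 0 → ∀ k, d k i = if k = i then 1 else 0)
    (he : ∀ i, e i ≠ 0 → ∀ k, e k i = if k = i then 1 else 0)
    (hed : ∀ i k, ∑ j, e i j * d j k = e i k) (hde : ∀ i k, ∑ j, d i j * e j k = d i k)
    {i : Fin n} (hi : d i ≠ 0) :
    ∃ l, (d i l = 1 ∧ ∀ k, k ≠ i → d k l = 0) ∧ e l = d i := by
  have h1 : ∑ j, d i j * e j i = 1 := by rw [hde, hd i hi]; simp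
  obtain ⟨l, -, hl⟩ := Finset.exists_ne_zero_of_sum_ne_zero (h1.trans_ne one_ne_zero)
  have hel : e l i ≠ 0 := right_ne_zero_of_mul hl
  have hl0 : e l ≠ 0 := by rintro h0; simp [h0] at hel
  have hdl : d i l = 1 := by
    have := Finset.single_le_sum (f := fun j => d i j * e j i) (fun _ _ => Nat.zero_le _)
      (Finset.mem_univ l)
    rw [h1] at this
    exact Nat.eq_one_of_mul_eq_one_right (m := d i l) (n := e l i) (by omega)
  refine ⟨l, ⟨hdl, fun k hk => ?_⟩, ?_⟩
  · have h0 : ∑ j, d k j * e j i = 0 := by rw [hde, hd i hi, if_neg hk]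
    exact (mul_eq_zero.1 (Finset.sum_eq_zero_iff.1 h0 l (Finset.mem_univ _))).resolve_right hel
  · ext k
    rw [← hde i k, Finset.sum_eq_single l, hdl, one_mul]
    · intro j _ hj
      by_cases hj0 : e j = 0
      · simp [hj0]
      · have h0 : ∑ m, e l m * d m j = 0 := by rw [hed, he j hj0, if_neg hj.symm]
        rw [(mul_eq_zero.1 (Finset.sum_eq_zero_iff.1 h0 i (Finset.mem_univ _))).resolve_left hel,
          zero_mul]
    · simp

/-- The number of monic monomial R-retractions of R[X_1,…,X_n] having the same
image as a given non-degenerate monic monomial R-retraction φ with exponent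
vectors d_i equals ∏_{i : d_i ≠ 0} |Γ_i|, where
Γ_i = { l | d_i(l) = 1 and d_k(l) = 0 for all k ≠ i }. -/
theorem card_retractions_with_same_image
    (R : Type*) [CommRing R] [Nontrivial R] (n : ℕ)
    (d : Fin n → (Fin n →₀ ℕ))
    (hφidem : (aeval (R := R) (fun i : Fin n => monomial (d i) (1 : R))).comp
        (aeval (R := R) (fun i : Fin n => monomial (d i) (1 : R))) =
      aeval (R := R) (fun i : Fin n => monomial (d i) (1 : R)))
    (hdnd : ∀ j : Fin n, ∃ i : Fin n, d i j ≠ 0) :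
    {e : Fin n → (Fin n →₀ ℕ) |
        ((aeval (R := R) (fun i : Fin n => monomial (e i) (1 : R))).comp
            (aeval (R := R) (fun i : Fin n => monomial (e i) (1 : R))) =
          aeval (R := R) (fun i : Fin n => monomial (e i) (1 : R))) ∧
        (aeval (R := R) (fun i : Fin n => monomial (e i) (1 : R))).range =
          (aeval (R := R) (fun i : Fin n => monomial (d i) (1 : R))).range}.ncard =
      ∏ i ∈ Finset.univ.filter (fun i : Fin n => d i ≠ 0),
        {l : Fin n | d i l = 1 ∧ ∀ k : Fin n, k ≠ i → d k l = 0}.ncard := by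
  have hd := (aeval_monomial_comp_eq_iff d d).1 hφidem
  have hdδ : ∀ i, d i ≠ 0 → ∀ k, d k i = if k = i then 1 else 0 := fun _ hi k =>
    apply_eq_ite_of_idempotent hd hdnd hi k
  have hset : {e : Fin n → (Fin n →₀ ℕ) |
        ((aeval (R := R) (fun i : Fin n => monomial (e i) (1 : R))).comp
            (aeval (R := R) (fun i : Fin n => monomial (e i) (1 : R))) =
          aeval (R := R) (fun i : Fin n => monomial (e i) (1 : R))) ∧
        (aeval (R := R) (fun i : Fin n => monomial (e i) (1 : R))).range =
          (aeval (R := R) (fun i : Fin n => monomial (d i) (1 : R))).range} =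
      {e | (∀ i k, ∑ j, e i j * d j k = e i k) ∧ ∀ i k, ∑ j, d i j * e j k = d i k} := by
    ext e
    simp only [Set.mem_ofPred_eq, ← aeval_monomial_comp_eq_iff (R := R)]
    constructor
    · rintro ⟨h1, h2⟩
      exact (AlgHom.range_eq_range_iff_of_comp_self h1 hφidem).1 h2
    · intro h
      have h1 : (aeval (R := R) (fun i : Fin n => monomial (e i) (1 : R))).comp
            (aeval (R := R) (fun i : Fin n => monomial (e i) (1 : R))) =
          aeval (R := R) (fun i : Fin n => monomial (e i) (1 : R)) :=
        AlgHom.comp_self_of_comp_eq h.1 h.2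
      exact ⟨h1, (AlgHom.range_eq_range_iff_of_comp_self h1 hφidem).2 h⟩
  have heδ : ∀ e : Fin n → (Fin n →₀ ℕ), (∀ i k, ∑ j, e i j * d j k = e i k) →
      (∀ i k, ∑ j, d i j * e j k = d i k) →
      ∀ i, e i ≠ 0 → ∀ k, e k i = if k = i then 1 else 0 := by
    intro e hed hde i hi k
    refine apply_eq_ite_of_idempotent ?_ ?_ hi k
    · have h1 := (aeval_monomial_comp_eq_iff (R := R) d e).2 hed
      have h2 := (aeval_monomial_comp_eq_iff (R := R) e d).2 hde
      exact (aeval_monomial_comp_eq_iff (R := R) e e).1 (AlgHom.comp_self_of_comp_eq h1 h2)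
    · intro j
      by_contra! h0
      obtain ⟨i, hi⟩ := hdnd j
      exact hi (by rw [← hde i j]; simp [h0])
  rw [hset, ← Nat.card_coe_set_eq, Finset.prod_subtype _ (p := fun i => d i ≠ 0) (by simp)]
  simp_rw [← Nat.card_coe_set_eq]
  rw [← Nat.card_pi]
  symm
  have eq_of_mem : ∀ {l i i' : Fin n}, d i l = 1 → (∀ k, k ≠ i' → d k l = 0) → i = i' := by
    intro l i i' h1 h2
    by_contra hne
    simp [h2 i hne] at h1
  have inj : ∀ c : (i : {i // d i ≠ 0}) →
      {l : Fin n | d i l = 1 ∧ ∀ k : Fin n, k ≠ i → d k l = 0},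
      Function.Injective fun i => (c i : Fin n) := by
    intro c i i' h
    exact Subtype.ext (eq_of_mem (c i).2.1 (by dsimp only at h; rw [h]; exact (c i').2.2))
  refine Nat.card_eq_of_bijective
    (fun c => ⟨relocate d fun i => (c i : Fin n), ?_, ?_⟩) ⟨?_, ?_⟩
  · intro l k
    by_cases hl : ∃ i, (c i : Fin n) = l
    · obtain ⟨i, rfl⟩ := hl
      simp only [relocate_of_injective (inj c) i, hd]
    · push Not at hl
      simp [relocate_of_forall_ne hl]
  · intro i k
    simp only [relocate_apply, Finset.mul_sum]
    rw [Finset.sum_comm]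
    simp only [mul_ite, mul_zero, Finset.sum_ite_eq, Finset.mem_univ, if_true]
    by_cases hi : d i = 0
    · simp [hi]
    · rw [Finset.sum_eq_single ⟨i, hi⟩]
      · rw [(c ⟨i, hi⟩).2.1, one_mul]
      · intro i' _ hne
        rw [(c i').2.2 i fun h => hne (Subtype.ext h.symm), zero_mul]
      · simp
  · intro c c' h
    have h' : (relocate d fun i => (c i : Fin n)) = relocate d fun i => (c' i : Fin n) :=
      congrArg Subtype.val h
    funext i
    have hi : relocate d (fun i => (c' i : Fin n)) (c i) = d i := by
      rw [← h']
      exact relocate_of_injective (inj c) i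
    by_cases hl : ∃ i', (c' i' : Fin n) = c i
    · obtain ⟨i', hi'⟩ := hl
      have : i = i' := Subtype.ext (eq_of_mem (c i).2.1 (by rw [← hi']; exact (c' i').2.2))
      subst this
      exact Subtype.ext hi'.symm
    · push Not at hl
      exact absurd (hi.symm.trans (relocate_of_forall_ne hl)) i.2
  · rintro ⟨e, hed, hde⟩
    have he := heδ e hed hde
    choose c hc hce using fun i : {i // d i ≠ 0} =>
      exists_eq_of_mutually_fixed hdδ he hed hde i.2
    refine ⟨fun i => ⟨c i, hc i⟩, Subtype.ext (funext fun l => ?_)⟩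
    by_cases hl : ∃ i, c i = l
    · obtain ⟨i, rfl⟩ := hl
      exact (relocate_of_injective (inj fun i => ⟨c i, hc i⟩) i).trans (hce i).symm
    · push Not at hl
      refine (relocate_of_forall_ne hl).trans ?_
      by_contra! hel
      have h1 : ∑ j, e l j * d j l ≠ 0 := by rw [hed, he l hel.symm]; simp
      obtain ⟨j, -, hj⟩ := Finset.exists_ne_zero_of_sum_ne_zero h1
      have hjl := right_ne_zero_of_mul hj
      have hj0 : d j ≠ 0 := by rintro h0; simp [h0] at hjl
      have h2 := he l hel.symm (c ⟨j, hj0⟩)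
      rw [hce, if_neg (hl _)] at h2
      exact hjl h2
end
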